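/- For k ≥ 3 with k ≡ 3 (mod 4) and any r ≥ 1, there exists a surjective group homomorphism from the higher dimensional Thompson group 2V_{k,r} onto the cyclic group ℤ/(2k−2)ℤ. -/

import Mathlib

namespace NV

/-- The Cantor space `C_k = {0,…,k-1}^ℕ` of one-sided infinite sequences. -/
abbrev Cantor (k : ℕ) : Type := ℕ → Fin k

/-- Concatenation `u·x` of a finite word `u` with an infinite sequence `x`. -/
def concat {k : ℕ} (u : List (Fin k)) (x : Cantor k) : Cantor k :=
  fun i => if h : i < u.length then u.get ⟨i, h⟩ else x (i - u.length)

/-- The space `Y(n,k,r) = (C_k)^n × {1,…,r}`. -/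
abbrev Y (n k r : ℕ) : Type := (Fin n → Cantor k) × Fin r

/-- The box `{(u_1·x_1,…,u_n·x_n, a) : x_1,…,x_n ∈ C_k}` determined by
finite words `u_1,…,u_n` and an index `a`. -/
def box {n k r : ℕ} (u : Fin n → List (Fin k)) (a : Fin r) : Set (Y n k r) :=
  {y | ∃ x : Fin n → Cantor k, y = (fun i => concat (u i) (x i), a)}

/-- A permutation of `Y(n,k,r)` is an element of the higher dimensional Thompson
group `nV_{k,r}` if there are finitely many tuples of words and indices whose domain
boxes partition `Y(n,k,r)`, whose range boxes partition `Y(n,k,r)`, and on which `γ`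
acts by the corresponding prefix substitutions. -/
def IsElement {n k r : ℕ} (γ : Equiv.Perm (Y n k r)) : Prop :=
  ∃ (m : ℕ) (u v : Fin m → Fin n → List (Fin k)) (a b : Fin m → Fin r),
    (∀ y : Y n k r, ∃! t : Fin m, y ∈ box (u t) (a t)) ∧
    (∀ y : Y n k r, ∃! t : Fin m, y ∈ box (v t) (b t)) ∧
    (∀ (t : Fin m) (x : Fin n → Cantor k),
      γ (fun i => concat (u t i) (x i), a t) = (fun i => concat (v t i) (x i), b t))

/-- The underlying set of the higher dimensional Thompson group `nV_{k,r}`,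
as a set of permutations of `Y(n,k,r)`. -/
def thompsonSet (n k r : ℕ) : Set (Equiv.Perm (Y n k r)) := {γ | IsElement γ}

end NV

namespace NV

section Words

variable {k : ℕ}

/-- `Inc u w` says that neither of the words `u`, `w` is a prefix of the other. -/
def Inc : List (Fin k) → List (Fin k) → Prop
  | [], _ => False
  | _ :: _, [] => False
  | a :: u, b :: w => a ≠ b ∨ Inc u w

/-- `Pre u x` says that the word `u` is a prefix of the sequence `x`. -/
def Pre : List (Fin k) → Cantor k → Prop
  | [], _ => True
  | a :: u, x => x 0 = a ∧ Pre u (fun i => x (i + 1))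

/-- The sequence `a·x` for a letter `a`. -/
def scons (a : Fin k) (x : Cantor k) : Cantor k
  | 0 => a
  | i + 1 => x i

lemma concat_nil (x : Cantor k) : concat [] x = x := by
  funext i; simp [concat]

lemma concat_cons (a : Fin k) (u : List (Fin k)) (x : Cantor k) :
    concat (a :: u) x = scons a (concat u x) := by
  funext i
  cases i with
  | zero => simp [concat, scons]
  | succ i => simp [concat, scons]

lemma concat_append (u w : List (Fin k)) (x : Cantor k) :
    concat (u ++ w) x = concat u (concat w x) := by
  induction u with
  | nil => simp [concat_nil]
  | cons a u ih => simp [concat_cons, ih]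

lemma scons_inj {a b : Fin k} {x y : Cantor k} (h : scons a x = scons b y) : a = b ∧ x = y :=
  ⟨congrFun h 0, funext fun i => congrFun h (i + 1)⟩

lemma scons_head_tail (x : Cantor k) : scons (x 0) (fun i => x (i + 1)) = x := by
  funext i; cases i <;> rfl

lemma pre_iff (u : List (Fin k)) (x : Cantor k) : Pre u x ↔ ∃ z, x = concat u z := by
  induction u generalizing x with
  | nil => simp [Pre, concat_nil]
  | cons a u ih =>
    simp only [Pre, ih, concat_cons]
    constructor
    · rintro ⟨h0, z, hz⟩
      exact ⟨z, by rw [← scons_head_tail x, h0, hz]⟩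
    · rintro ⟨z, rfl⟩
      exact ⟨rfl, z, rfl⟩

lemma Pre.not_inc {u w : List (Fin k)} {x : Cantor k} (hu : Pre u x) (hw : Pre w x) :
    ¬ Inc u w := by
  induction u generalizing w x with
  | nil => simp [Inc]
  | cons a u ih =>
    cases w with
    | nil => simp [Inc]
    | cons b w =>
      rintro (h | h)
      · exact h (hu.1.symm.trans hw.1)
      · exact ih hu.2 hw.2 h

lemma exists_pre_of_not_inc (h0 : 0 < k) {u w : List (Fin k)} (h : ¬ Inc u w) :
    ∃ x, Pre u x ∧ Pre w x := by
  induction u generalizing w with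
  | nil => exact ⟨concat w fun _ => ⟨0, h0⟩, trivial, (pre_iff _ _).2 ⟨_, rfl⟩⟩
  | cons a u ih =>
    cases w with
    | nil => exact ⟨concat (a :: u) fun _ => ⟨0, h0⟩, (pre_iff _ _).2 ⟨_, rfl⟩, trivial⟩
    | cons b w =>
      simp only [Inc, not_or, not_not] at h
      obtain ⟨x, hx, hx'⟩ := ih h.2
      exact ⟨scons a x, ⟨rfl, hx⟩, ⟨h.1, hx'⟩⟩

lemma eq_of_not_inc {u w : List (Fin k)} (hl : u.length = w.length) (h : ¬ Inc u w) :
    u = w := by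
  induction u generalizing w with
  | nil => exact (List.length_eq_zero_iff.1 hl.symm).symm
  | cons a u ih =>
    cases w with
    | nil => simp at hl
    | cons b w =>
      simp only [Inc, not_or, not_not] at h
      rw [h.1, ih (by simpa using hl) h.2]

lemma not_inc_self (u : List (Fin k)) : ¬ Inc u u := by
  induction u with
  | nil => simp [Inc]
  | cons a u ih => simp [Inc, ih]

lemma Inc.symm {u w : List (Fin k)} (h : Inc u w) : Inc w u := by
  induction u generalizing w with
  | nil => exact h.elim
  | cons a u ih =>
    cases w with
    | nil => exact h.elim
    | cons b w => exact h.imp Ne.symm ih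

lemma Inc.append_left {u w : List (Fin k)} (h : Inc u w) (z : List (Fin k)) :
    Inc (u ++ z) w := by
  induction u generalizing w with
  | nil => exact h.elim
  | cons a u ih =>
    cases w with
    | nil => exact h.elim
    | cons b w => exact h.imp id ih

lemma inc_concat_concat (u : List (Fin k)) {i j : Fin k} (h : i ≠ j) :
    Inc (u ++ [i]) (u ++ [j]) := by
  induction u with
  | nil => exact Or.inl h
  | cons a u ih => exact Or.inr ih

/-- Prefixing is injective in the word as soon as the alphabet has two letters. -/
lemma word_eq_of_concat_eq (h2 : 2 ≤ k) {u w : List (Fin k)}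
    (h : ∀ x, concat u x = concat w x) : u = w := by
  have key : ∀ (a : Fin k) (u : List (Fin k)), ¬ ∀ x, concat (a :: u) x = x := by
    intro a u h
    have h0 := congrFun (h fun _ => ⟨0, by omega⟩) 0
    have h1 := congrFun (h fun _ => ⟨1, by omega⟩) 0
    simp only [concat_cons, scons] at h0 h1
    simp [h0] at h1
  induction u generalizing w with
  | nil =>
    cases w with
    | nil => rfl
    | cons b w => exact (key b w fun x => by rw [← h, concat_nil]).elim
  | cons a u ih =>
    cases w with
    | nil => exact (key a u fun x => by rw [h, concat_nil]).elim
    | cons b w =>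
      have h' : ∀ x, a = b ∧ concat u x = concat w x := fun x =>
        scons_inj (by simpa only [concat_cons] using h x)
      rw [(h' fun _ => a).1, ih fun x => (h' x).2]

end Words

section Orientation

variable {k r : ℕ}

/-- The element `k - 1` of `ℤ/(2k-2)`, which is of order two. -/
def kap (k : ℕ) : ZMod (2 * k - 2) := (k : ZMod (2 * k - 2)) - 1

lemma two_kap (hk : 1 ≤ k) : 2 * kap k = 0 := by
  have h := ZMod.natCast_self (2 * k - 2)
  rw [Nat.cast_sub (by omega)] at h
  push_cast at h
  rw [kap]
  linear_combination h

lemma even_mul_kap (hk : 1 ≤ k) {n : ℕ} (hn : Even n) : (n : ZMod (2 * k - 2)) * kap k = 0 := by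
  obtain ⟨m, rfl⟩ := hn
  push_cast
  linear_combination (m : ZMod (2 * k - 2)) * two_kap hk

lemma odd_mul_kap (hk : 1 ≤ k) {n : ℕ} (hn : Odd n) :
    (n : ZMod (2 * k - 2)) * kap k = kap k := by
  obtain ⟨m, rfl⟩ := hn
  push_cast
  linear_combination (m : ZMod (2 * k - 2)) * two_kap hk

lemma cast_mul_self (hk : k % 4 = 3) : (k : ZMod (2 * k - 2)) * k = 1 := by
  have h1 := odd_mul_kap (k := k) (by omega) (n := k) (Nat.odd_iff.2 (by omega))
  have h2 := two_kap (k := k) (by omega)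
  rw [kap] at h1 h2
  linear_combination h1 + h2

lemma odd_choose_two (hk : k % 4 = 3) : Odd (k.choose 2) := by
  obtain ⟨m, rfl⟩ : ∃ m, k = 4 * m + 3 := ⟨k / 4, by omega⟩
  rw [Nat.choose_two_right, show (4 * m + 3) * (4 * m + 3 - 1) = 2 * ((4 * m + 3) * (2 * m + 1)) by
    rw [show 4 * m + 3 - 1 = 2 * (2 * m + 1) by omega]; ring, Nat.mul_div_cancel_left _ two_pos]
  exact Nat.odd_mul.2 ⟨⟨2 * m + 1, by ring⟩, ⟨m, rfl⟩⟩

/-- The sum of the letters of a word. -/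
def dsum (u : List (Fin k)) : ℕ := (u.map Fin.val).sum

lemma dsum_cons (a : Fin k) (u : List (Fin k)) : dsum (a :: u) = a + dsum u := by
  simp [dsum]

lemma dsum_concat (u : List (Fin k)) (a : Fin k) : dsum (u ++ [a]) = dsum u + a := by
  simp [dsum]

/-- The lexicographic inversion indicator of two words, `0` if they are comparable. -/
def winv : List (Fin k) → List (Fin k) → ZMod (2 * k - 2)
  | [], _ => 0
  | _ :: _, [] => 0
  | a :: u, b :: w => if a = b then winv u w else if b < a then kap k else 0

/-- The lexicographic inversion indicator of two incomparable words; on comparable words, `X`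
corrected by the letter sums and the larger length. -/
def hinv : ZMod (2 * k - 2) → List (Fin k) → List (Fin k) → ZMod (2 * k - 2)
  | X, [], w => kap k * (dsum w + w.length) + X
  | X, a :: u, [] => kap k * (dsum (a :: u) + (a :: u).length) + X
  | X, a :: u, b :: w => if a = b then hinv (X + kap k) u w else if b < a then kap k else 0

lemma hinv_of_inc (X X' : ZMod (2 * k - 2)) {u w : List (Fin k)} (h : Inc u w) :
    hinv X u w = hinv X' u w := by
  induction u generalizing w X X' with
  | nil => exact h.elim
  | cons a u ih =>
    cases w with
    | nil => exact h.elim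
    | cons b w =>
      simp only [hinv]
      split_ifs with hab
      · exact ih _ _ (h.resolve_left (not_not.2 hab))
      · rfl
      · rfl

lemma winv_antisymm (hk : 1 ≤ k) {u w : List (Fin k)} (h : Inc u w) :
    winv u w = winv w u + kap k := by
  have h2 := two_kap hk
  induction u generalizing w with
  | nil => exact h.elim
  | cons a u ih =>
    cases w with
    | nil => exact h.elim
    | cons b w =>
      simp only [winv, eq_comm (a := b)]
      split_ifs with hab hba hab'
      · exact ih (h.resolve_left (not_not.2 hab))
      · exact absurd hba (lt_asymm hab')
      · ring
      · linear_combination -h2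
      · omega

lemma hinv_antisymm (hk : 1 ≤ k) {X X' : ZMod (2 * k - 2)} {u w : List (Fin k)}
    (h : Inc u w ∨ X = X' + kap k) : hinv X u w = hinv X' w u + kap k := by
  have h2 := two_kap hk
  induction u generalizing w X X' with
  | nil =>
    obtain rfl := h.resolve_left id
    cases w <;> simp only [hinv] <;> ring
  | cons a u ih =>
    cases w with
    | nil =>
      obtain rfl := h.resolve_left id
      simp only [hinv]; ring
    | cons b w =>
      simp only [hinv, eq_comm (a := b)]
      split_ifs with hab hba hab'
      · exact ih (h.imp (fun h => h.resolve_left (not_not.2 hab)) fun h => by rw [h])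
      · exact absurd hba (lt_asymm hab')
      · ring
      · linear_combination -h2
      · omega

lemma winv_append {u w : List (Fin k)} (h : Inc u w) (z : List (Fin k)) :
    winv (u ++ z) w = winv u w := by
  induction u generalizing w with
  | nil => exact h.elim
  | cons a u ih =>
    cases w with
    | nil => exact h.elim
    | cons b w =>
      simp only [List.cons_append, winv]
      split_ifs with hab
      · exact ih (h.resolve_left (not_not.2 hab))
      · rfl
      · rfl

lemma winv_concat_concat (u : List (Fin k)) {i j : Fin k} (h : i < j) :
    winv (u ++ [i]) (u ++ [j]) = 0 := by
  induction u with
  | nil => simp [winv, h.ne, h.le]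
  | cons a u ih => simpa [winv] using ih

lemma hinv_self (X : ZMod (2 * k - 2)) (u : List (Fin k)) :
    hinv X u u = kap k * u.length + X := by
  induction u generalizing X with
  | nil => simp [hinv, dsum]
  | cons a u ih => simp only [hinv, if_true, ih, List.length_cons]; push_cast; ring

lemma hinv_concat_concat (X : ZMod (2 * k - 2)) (u : List (Fin k)) {i j : Fin k} (h : i < j) :
    hinv X (u ++ [i]) (u ++ [j]) = 0 := by
  induction u generalizing X with
  | nil => simp [hinv, h.ne, h.le]
  | cons a u ih => simpa [hinv] using ih _

lemma sum_mul_kap (hk : k % 4 = 3) (c : ZMod (2 * k - 2)) :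
    ∑ j : Fin k, kap k * ((j : ZMod (2 * k - 2)) + c) = kap k + kap k * c := by
  have hs : ∑ j : Fin k, (j : ZMod (2 * k - 2)) = k.choose 2 := by
    rw [Fin.sum_univ_eq_sum_range (fun j => (j : ZMod (2 * k - 2))), ← Nat.cast_sum,
      Finset.sum_range_id, Nat.choose_two_right]
  rw [← Finset.mul_sum, Finset.sum_add_distrib, hs]
  simp only [Finset.sum_const, Finset.card_univ, Fintype.card_fin, nsmul_eq_mul]
  linear_combination odd_mul_kap (k := k) (by omega) (odd_choose_two hk) +
    c * odd_mul_kap (k := k) (by omega) (n := k) (Nat.odd_iff.2 (by omega))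

/-- The inversion indicator of a word is the sum of those of its one-letter extensions. -/
lemma sum_hinv_concat (hk : k % 4 = 3) {X : ZMod (2 * k - 2)} (hX : k * X = X)
    (u w : List (Fin k)) : ∑ j, hinv X (u ++ [j]) w = hinv X u w := by
  have hk1 : 1 ≤ k := by omega
  have h2 := two_kap hk1
  have hkk := odd_mul_kap hk1 (n := k) (Nat.odd_iff.2 (by omega))
  have hnil : ∀ X : ZMod (2 * k - 2), k * X = X → ∀ u : List (Fin k), ∑ j : Fin k, (kap k * (dsum (u ++ [j]) + (u ++ [j]).length) + X)
      = kap k * (dsum u + u.length) + X := by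
    intro X hX u
    have h := sum_mul_kap hk (dsum u + u.length + 1 : ZMod (2 * k - 2))
    rw [Finset.sum_add_distrib]
    have hrw : ∀ j : Fin k, kap k * ((dsum (u ++ [j]) : ZMod (2 * k - 2)) +
        ((u ++ [j]).length : ℕ)) = kap k * ((j : ZMod (2 * k - 2)) + (dsum u + u.length + 1)) := by
      intro j
      simp only [dsum_concat, List.length_append, List.length_singleton]
      push_cast
      ring
    rw [Finset.sum_congr rfl fun j _ => hrw j, h]
    simp only [Finset.sum_const, Finset.card_univ, Fintype.card_fin, nsmul_eq_mul]
    linear_combination hX + h2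
  induction u generalizing w X with
  | nil =>
    cases w with
    | nil => simpa only [List.nil_append, hinv] using hnil X hX []
    | cons b w =>
      have hc : ∑ j : Fin k, (if b < j then kap k else 0) = (b : ℕ) * kap k := by
        rw [← Finset.sum_filter, Finset.sum_const, nsmul_eq_mul,
          show Finset.univ.filter (b < ·) = Finset.Ioi b by ext; simp, Fin.card_Ioi]
        have : ((k - 1 - (b : ℕ) : ℕ) : ZMod (2 * k - 2)) * kap k + (b : ℕ) * kap k = 0 := by
          rw [← add_mul, ← Nat.cast_add, Nat.sub_add_cancel (by omega)]
          exact even_mul_kap hk1 (Nat.even_iff.2 (by omega))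
        linear_combination this - ((b : ℕ) : ZMod (2 * k - 2)) * h2
      have hsplit : ∀ j : Fin k, hinv X ([] ++ [j]) (b :: w)
          = (if j = b then hinv (X + kap k) [] w else 0) + if b < j then kap k else 0 := by
        intro j
        simp only [List.nil_append, hinv]
        split_ifs with h h'
        · omega
        · ring
        · ring
        · ring
      rw [Finset.sum_congr rfl fun j _ => hsplit j, Finset.sum_add_distrib, hc]
      simp only [Finset.sum_ite_eq', Finset.mem_univ, if_true, hinv, dsum_cons, List.length_cons]
      push_cast
      ring
  | cons a u ih =>
    cases w with
    | nil => simpa only [List.cons_append, hinv] using hnil X hX (a :: u)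
    | cons b w =>
      simp only [List.cons_append, hinv]
      split_ifs with hab
      · exact ih (by rw [mul_add, hX, hkk]) w
      · simp [hkk]
      · simp

end Orientation

section Boxes

variable {k r : ℕ}

/-- The words and the index that determine a box of `Y(2,k,r)`. -/
abbrev Box (k r : ℕ) : Type := (Fin 2 → List (Fin k)) × Fin r

/-- Combinatorial disjointness of boxes. -/
def Dis (B B' : Box k r) : Prop := B.2 ≠ B'.2 ∨ ∃ i, Inc (B.1 i) (B'.1 i)

lemma Dis.symm {B B' : Box k r} (h : Dis B B') : Dis B' B :=
  h.imp Ne.symm fun ⟨i, hi⟩ => ⟨i, hi.symm⟩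

lemma not_dis_self (B : Box k r) : ¬ Dis B B := by
  simp [Dis, not_inc_self]

/-- The `j`-th part of the box `B` when it is cut in the direction `i`. -/
def spl (i : Fin 2) (B : Box k r) (j : Fin k) : Box k r :=
  (Function.update B.1 i (B.1 i ++ [j]), B.2)

/-- The parts of the box `B` when it is cut in the direction `i`. -/
def splits (i : Fin 2) (B : Box k r) : List (Box k r) := (List.finRange k).map (spl i B)

lemma Dis.spl_left {B B' : Box k r} (h : Dis B B') (i : Fin 2) (j : Fin k) :
    Dis (spl i B j) B' := by
  refine h.imp id ?_
  rintro ⟨i', hi⟩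
  refine ⟨i', ?_⟩
  by_cases h : i' = i
  · subst h
    simpa [spl] using hi.append_left [j]
  · simpa [spl, h] using hi

lemma dis_spl_spl (i : Fin 2) (B : Box k r) {j j' : Fin k} (h : j ≠ j') :
    Dis (spl i B j) (spl i B j') :=
  Or.inr ⟨i, by simpa [spl] using inc_concat_concat (B.1 i) h⟩

/-- The inversion indicator of two disjoint boxes. -/
def binv (B B' : Box k r) : ZMod (2 * k - 2) :=
  if B.2 = B'.2 then hinv (winv (B.1 1) (B'.1 1)) (B.1 0) (B'.1 0)
  else if B'.2 < B.2 then kap k else 0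

lemma binv_antisymm (hk : 1 ≤ k) {B B' : Box k r} (h : Dis B B') :
    binv B B' = binv B' B + kap k := by
  have h2 := two_kap hk
  unfold binv
  simp only [eq_comm (a := B'.2)]
  split_ifs with h1 h3 h4
  · apply hinv_antisymm hk
    obtain ⟨i, hi⟩ := h.resolve_left (not_not.2 h1)
    fin_cases i
    · exact Or.inl hi
    · exact Or.inr (winv_antisymm hk hi)
  · exact absurd h3 (lt_asymm h4)
  · ring
  · linear_combination -h2
  · omega

lemma mul_winv (hk : k % 4 = 3) (u w : List (Fin k)) :
    (k : ZMod (2 * k - 2)) * winv u w = winv u w := by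
  have hkk := odd_mul_kap (k := k) (by omega) (n := k) (Nat.odd_iff.2 (by omega))
  induction u generalizing w with
  | nil => simp [winv]
  | cons a u ih =>
    cases w with
    | nil => simp [winv]
    | cons b w =>
      simp only [winv]
      split_ifs
      · exact ih w
      · exact hkk
      · simp

lemma mul_hinv (hk : k % 4 = 3) {X : ZMod (2 * k - 2)} (hX : k * X = X) (u w : List (Fin k)) :
    (k : ZMod (2 * k - 2)) * hinv X u w = hinv X u w := by
  have hkk := odd_mul_kap (k := k) (by omega) (n := k) (Nat.odd_iff.2 (by omega))
  induction u generalizing w X with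
  | nil =>
    simp only [hinv]
    linear_combination (dsum w + w.length : ZMod (2 * k - 2)) * hkk + hX
  | cons a u ih =>
    cases w with
    | nil =>
      simp only [hinv]
      linear_combination
        (dsum (a :: u) + (a :: u).length : ZMod (2 * k - 2)) * hkk + hX
    | cons b w =>
      simp only [hinv]
      split_ifs
      · exact ih (by rw [mul_add, hX, hkk]) w
      · exact hkk
      · simp

lemma mul_binv (hk : k % 4 = 3) (B B' : Box k r) :
    (k : ZMod (2 * k - 2)) * binv B B' = binv B B' := by
  have hkk := odd_mul_kap (k := k) (by omega) (n := k) (Nat.odd_iff.2 (by omega))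
  unfold binv
  split_ifs
  · exact mul_hinv hk (mul_winv hk _ _) _ _
  · exact hkk
  · simp

lemma sum_binv_spl (hk : k % 4 = 3) {B B' : Box k r} (h : Dis B B') (i : Fin 2) :
    ∑ j, binv (spl i B j) B' = binv B B' := by
  have hconst : (∀ j, binv (spl i B j) B' = binv B B') →
      ∑ j, binv (spl i B j) B' = binv B B' := by
    intro h
    rw [Finset.sum_congr rfl fun j _ => h j]
    simpa using mul_binv hk B B'
  by_cases h1 : B.2 = B'.2
  · obtain ⟨i', hi⟩ := h.resolve_left (not_not.2 h1)
    fin_cases i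
    · simpa [binv, spl, h1] using sum_hinv_concat hk (mul_winv hk _ _) (B.1 0) (B'.1 0)
    · apply hconst
      intro j
      fin_cases i'
      · simpa [binv, spl, h1] using hinv_of_inc _ _ hi
      · simp only [Fin.mk_one] at hi
        simp [binv, spl, h1, winv_append hi]
  · apply hconst
    intro j
    unfold binv
    rw [if_neg h1, if_neg (by exact h1)]
    rfl

/-- The geometric sum `1 + k + ⋯ + k^(a-1)` in `ℤ/(2k-2)`. -/
def geo (k : ℕ) : ℕ → ZMod (2 * k - 2)
  | 0 => 0
  | a + 1 => k * geo k a + 1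

lemma kap_mul_geo (hk : k % 4 = 3) (a : ℕ) : kap k * geo k a = kap k * a := by
  have hkk := odd_mul_kap (k := k) (by omega) (n := k) (Nat.odd_iff.2 (by omega))
  induction a with
  | zero => simp [geo]
  | succ a ih =>
    rw [geo]
    push_cast
    linear_combination geo k a * hkk + ih

/-- The orientation number of an ordered list of boxes. -/
def ori : List (Box k r) → ZMod (2 * k - 2)
  | [] => 0
  | B :: L => geo k (B.1 0).length + (L.map (binv B)).sum + ori L

lemma ori_append (A L : List (Box k r)) :
    ori (A ++ L) = ori A + ori L + (A.map fun B => (L.map (binv B)).sum).sum := by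
  induction A with
  | nil => simp [ori]
  | cons B A ih =>
    simp only [List.cons_append, ori, ih, List.map_append, List.sum_append, List.map_cons,
      List.sum_cons]
    ring

lemma ori_of_const {A : List (Box k r)} {g d : ZMod (2 * k - 2)}
    (hg : ∀ B ∈ A, geo k (B.1 0).length = g) (hd : A.Pairwise fun B B' => binv B B' = d) :
    ori A = A.length * g + A.length.choose 2 * d := by
  induction A with
  | nil => simp [ori]
  | cons B A ih =>
    rw [List.pairwise_cons] at hd
    rw [ori, hg B (by simp), ih (fun B' h => hg B' (by simp [h])) hd.2,
      List.map_congr_left (g := fun _ => d) hd.1]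
    simp only [List.map_const', List.sum_replicate, nsmul_eq_mul, List.length_cons,
      Nat.choose_succ_succ' _ 1, Nat.choose_one_right]
    push_cast
    ring

lemma ori_splits (hk : k % 4 = 3) (i : Fin 2) (B : Box k r) :
    ori (splits i B) = geo k (B.1 0).length + if i = 0 then (k : ZMod (2 * k - 2)) else 0 := by
  have hlen : (splits i B).length = k := by simp [splits]
  have hlt : (List.finRange k).Pairwise (· < ·) := List.pairwise_lt_finRange k
  have hkk := cast_mul_self hk
  have hc := odd_mul_kap (k := k) (by omega) (odd_choose_two hk)
  fin_cases i
  · rw [ori_of_const (g := geo k ((B.1 0).length + 1)) (d := 0), hlen]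
    · simp only [geo, Fin.zero_eta, if_true]
      linear_combination geo k (B.1 0).length * hkk
    · intro B' hB'
      obtain ⟨j, -, rfl⟩ := List.mem_map.1 hB'
      simp [spl]
    · rw [splits, List.pairwise_map]
      refine hlt.imp fun {j j'} h => ?_
      simpa [binv, spl] using hinv_concat_concat _ (B.1 0) h
  · rw [ori_of_const (g := geo k (B.1 0).length) (d := kap k * (B.1 0).length), hlen]
    · have h1 := kap_mul_geo hk (B.1 0).length
      have h2 := two_kap (k := k) (by omega)
      have h3 : (k : ZMod (2 * k - 2)) = kap k + 1 := by rw [kap]; ring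
      simp only [Fin.mk_one, one_ne_zero, if_false]
      rw [← mul_assoc, hc, ← h1, h3]
      linear_combination geo k (B.1 0).length * h2
    · intro B' hB'
      obtain ⟨j, -, rfl⟩ := List.mem_map.1 hB'
      simp [spl]
    · rw [splits, List.pairwise_map]
      refine hlt.imp fun {j j'} h => ?_
      simp [binv, spl, hinv_self, winv_concat_concat _ h]

lemma ori_splits_append (hk : k % 4 = 3) (i : Fin 2) {B : Box k r} {L : List (Box k r)}
    (h : ∀ B' ∈ L, Dis B B') :
    ori (splits i B ++ L) = ori (B :: L) + if i = 0 then (k : ZMod (2 * k - 2)) else 0 := by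
  have hs : ((splits i B).map fun B => (L.map (binv B)).sum).sum = (L.map (binv B)).sum := by
    induction L with
    | nil => simp
    | cons B' L ih =>
      simp only [List.map_cons, List.sum_cons, List.sum_map_add]
      rw [ih fun B'' h' => h B'' (by simp [h'])]
      congr 1
      rw [← sum_binv_spl hk (h B' (by simp)) i, splits, List.map_map, ← List.sum_ofFn,
        List.ofFn_eq_map]
      rfl
  rw [ori_append, hs, ori_splits hk, ori]
  ring

/-- The change of the orientation number between the first and the second components of a list
of pairs of boxes. -/
def Phi (L : List (Box k r × Box k r)) : ZMod (2 * k - 2) :=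
  ori (L.map Prod.snd) - ori (L.map Prod.fst)

/-- Both components of a list of pairs of boxes are pairwise disjoint. -/
def PairDis (L : List (Box k r × Box k r)) : Prop :=
  L.Pairwise fun e e' => Dis e.1 e'.1 ∧ Dis e.2 e'.2

lemma PairDis.perm {L L' : List (Box k r × Box k r)} (hL : PairDis L) (h : L.Perm L') :
    PairDis L' :=
  (h.pairwise_iff fun h => ⟨h.1.symm, h.2.symm⟩).1 hL

lemma Phi_perm (hk : 1 ≤ k) {L L' : List (Box k r × Box k r)} (h : L.Perm L') (hL : PairDis L) :
    Phi L = Phi L' := by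
  induction h with
  | nil => rfl
  | @cons e L L' h ih =>
    have ih := ih (List.pairwise_cons.1 hL).2
    simp only [Phi, List.map_cons, ori] at ih ⊢
    rw [((h.map Prod.fst).map (binv e.1)).sum_eq, ((h.map Prod.snd).map (binv e.2)).sum_eq]
    linear_combination ih
  | swap e e' L =>
    have h := (List.pairwise_cons.1 hL).1 e (by simp)
    simp only [Phi, List.map_cons, ori, List.sum_cons]
    linear_combination binv_antisymm hk h.2 - binv_antisymm hk h.1
  | trans h _ ih ih' => exact (ih hL).trans (ih' (hL.perm h))

/-- The simultaneous cut in the direction `i` of a pair of boxes. -/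
def pairSplits (i : Fin 2) (e : Box k r × Box k r) : List (Box k r × Box k r) :=
  (List.finRange k).map fun j => (spl i e.1 j, spl i e.2 j)

lemma Phi_pairSplits (hk : k % 4 = 3) (i : Fin 2) {e : Box k r × Box k r}
    {L : List (Box k r × Box k r)} (h : PairDis (e :: L)) :
    Phi (pairSplits i e ++ L) = Phi (e :: L) := by
  have h' := (List.pairwise_cons.1 h).1
  have h1 := ori_splits_append hk i (B := e.1) (L := L.map Prod.fst) (by
    intro B hB
    obtain ⟨e', he', rfl⟩ := List.mem_map.1 hB
    exact (h' e' he').1)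
  have h2 := ori_splits_append hk i (B := e.2) (L := L.map Prod.snd) (by
    intro B hB
    obtain ⟨e', he', rfl⟩ := List.mem_map.1 hB
    exact (h' e' he').2)
  simp only [Phi, List.map_append, pairSplits, List.map_map, List.map_cons]
  change ori (splits i e.2 ++ _) - ori (splits i e.1 ++ _) = _
  linear_combination h2 - h1

end Boxes

section Tables

variable {k r : ℕ}

lemma not_dis_of_mem {B B' : Box k r} {y : Y 2 k r} (h : y ∈ box B.1 B.2)
    (h' : y ∈ box B'.1 B'.2) : ¬ Dis B B' := by
  obtain ⟨x, rfl⟩ := h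
  obtain ⟨x', hx'⟩ := h'
  obtain ⟨h1, h2⟩ := Prod.ext_iff.1 hx'
  rintro (hne | ⟨i, hi⟩)
  · exact hne h2
  · exact ((pre_iff _ _).2 ⟨x i, rfl⟩).not_inc ((pre_iff _ _).2 ⟨x' i, congrFun h1 i⟩) hi

lemma exists_mem_of_not_dis (hk : 0 < k) {B B' : Box k r} (h : ¬ Dis B B') :
    ∃ y : Y 2 k r, y ∈ box B.1 B.2 ∧ y ∈ box B'.1 B'.2 := by
  simp only [Dis, not_or, not_not, not_exists] at h
  choose y hy hy' using fun i => exists_pre_of_not_inc hk (h.2 i)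
  choose x hx using fun i => (pre_iff _ _).1 (hy i)
  choose x' hx' using fun i => (pre_iff _ _).1 (hy' i)
  exact ⟨(y, B.2), ⟨x, Prod.ext (funext hx) rfl⟩, ⟨x', Prod.ext (funext hx') h.1⟩⟩

/-- The point of the box `B` with coordinates `x`. -/
def pt (B : Box k r) (x : Fin 2 → Cantor k) : Y 2 k r := (fun i => concat (B.1 i) (x i), B.2)

lemma pt_mem (B : Box k r) (x : Fin 2 → Cantor k) : pt B x ∈ box B.1 B.2 := ⟨x, rfl⟩

lemma pt_spl (i : Fin 2) (B : Box k r) (j : Fin k) (x : Fin 2 → Cantor k) :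
    pt (spl i B j) x = pt B (Function.update x i (scons j (x i))) := by
  refine Prod.ext (funext fun i' => ?_) rfl
  by_cases h : i' = i
  · subst h
    simp [pt, spl, concat_append, concat_cons, concat_nil]
  · simp [pt, spl, h]

lemma exists_mem_spl (i : Fin 2) {B : Box k r} {y : Y 2 k r} (h : y ∈ box B.1 B.2) :
    ∃ j, y ∈ box (spl i B j).1 (spl i B j).2 := by
  obtain ⟨x, rfl⟩ := h
  refine ⟨x i 0, Function.update x i fun n => x i (n + 1), ?_⟩
  change pt B x = pt (spl i B (x i 0)) _
  simp [pt_spl, scons_head_tail]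

/-- `L` is a list of prefix substitutions performed by `γ` whose domain boxes form a partition. -/
structure IsTable (γ : Equiv.Perm (Y 2 k r)) (L : List (Box k r × Box k r)) : Prop where
  valid : ∀ e ∈ L, ∀ x, γ (pt e.1 x) = pt e.2 x
  cover : ∀ y : Y 2 k r, ∃ e ∈ L, y ∈ box e.1.1 e.1.2
  dis : L.Pairwise fun e e' => Dis e.1 e'.1

variable {γ δ : Equiv.Perm (Y 2 k r)} {L K : List (Box k r × Box k r)}

lemma IsTable.perm (hL : IsTable γ L) (h : L.Perm K) : IsTable γ K where
  valid e he := hL.valid e (h.mem_iff.2 he)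
  cover y := by simpa only [h.mem_iff] using hL.cover y
  dis := (h.pairwise_iff fun h => h.symm).1 hL.dis

lemma IsTable.pairDis (hk : 0 < k) (hL : IsTable γ L) : PairDis L := by
  refine hL.dis.imp_of_mem fun {e e'} he he' h => ⟨h, ?_⟩
  by_contra hn
  obtain ⟨y, ⟨x, hx⟩, ⟨x', hx'⟩⟩ := exists_mem_of_not_dis hk hn
  have h1 := hL.valid e he x
  have h2 := hL.valid e' he' x'
  have : pt e.1 x = pt e'.1 x' := γ.injective (by rw [h1, h2]; exact hx.symm.trans hx')
  exact not_dis_of_mem (pt_mem e.1 x) (this ▸ pt_mem e'.1 x') h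

lemma IsTable.inv (hk : 0 < k) (hL : IsTable γ L) : IsTable γ⁻¹ (L.map Prod.swap) where
  valid e he x := by
    obtain ⟨e', he', rfl⟩ := List.mem_map.1 he
    rw [Equiv.Perm.inv_eq_iff_eq]
    exact (hL.valid e' he' x).symm
  cover y := by
    obtain ⟨e, he, x, hx⟩ := hL.cover (γ⁻¹ y)
    refine ⟨e.swap, List.mem_map_of_mem he, x, ?_⟩
    have h := hL.valid e he x
    rw [Equiv.Perm.inv_eq_iff_eq] at hx
    rw [hx]
    exact h
  dis := by
    rw [List.pairwise_map]
    exact (hL.pairDis hk).imp fun h => h.2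

lemma IsTable.pairSplits (i : Fin 2) {e : Box k r × Box k r} (hL : IsTable γ (e :: L)) :
    IsTable γ (pairSplits i e ++ L) where
  valid e' he' x := by
    rcases List.mem_append.1 he' with h | h
    · obtain ⟨j, -, rfl⟩ := List.mem_map.1 h
      simp only [pt_spl]
      exact hL.valid e (by simp) _
    · exact hL.valid e' (by simp [h]) x
  cover y := by
    obtain ⟨e', he', hy⟩ := hL.cover y
    rcases List.mem_cons.1 he' with rfl | h
    · obtain ⟨j, hj⟩ := exists_mem_spl i hy
      exact ⟨(spl i e'.1 j, spl i e'.2 j), List.mem_append_left _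
        (List.mem_map.2 ⟨j, List.mem_finRange j, rfl⟩), hj⟩
    · exact ⟨e', List.mem_append_right _ h, hy⟩
  dis := by
    obtain ⟨h1, h2⟩ := List.pairwise_cons.1 hL.dis
    refine List.pairwise_append.2 ⟨?_, h2, ?_⟩
    · rw [NV.pairSplits, List.pairwise_map]
      exact (List.nodup_finRange k).imp fun h => dis_spl_spl i e.1 h
    · intro a ha b hb
      obtain ⟨j, -, rfl⟩ := List.mem_map.1 ha
      exact (h1 b hb).spl_left i j

lemma Phi_swap : Phi (L.map Prod.swap) = - Phi L := by
  simp only [Phi, List.map_map]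
  change ori (L.map Prod.fst) - ori (L.map Prod.snd) = _
  ring

/-- All domain boxes of `L` have words of length `N`. -/
def DomGrid (N : ℕ) (L : List (Box k r × Box k r)) : Prop :=
  ∀ e ∈ L, ∀ i, (e.1.1 i).length = N

lemma exists_domGrid (hk : k % 4 = 3) {N : ℕ} (hL : IsTable γ L)
    (hN : ∀ e ∈ L, ∀ i, (e.1.1 i).length ≤ N) :
    ∃ K, IsTable γ K ∧ Phi K = Phi L ∧ DomGrid N K := by
  let w : Box k r × Box k r → ℕ := fun e =>
    (k + 1) ^ ((N - (e.1.1 0).length) + (N - (e.1.1 1).length))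
  induction hs : (L.map w).sum using Nat.strong_induction_on generalizing L with
  | _ s ih =>
    by_cases hgrid : DomGrid N L
    · exact ⟨L, hL, rfl, hgrid⟩
    simp only [DomGrid, not_forall] at hgrid
    obtain ⟨e, he, i, hi⟩ := hgrid
    have hp := List.perm_cons_erase he
    have hLe := hL.perm hp
    have hlt : (e.1.1 i).length < N := lt_of_le_of_ne (hN e he i) hi
    have hw : ((NV.pairSplits i e).map w).sum < w e := by
      have hpos : 0 < (k + 1) ^ ((N - (e.1.1 0).length) + (N - (e.1.1 1).length) - 1) := by
        positivity
      have h1 : ∀ j, w (spl i e.1 j, spl i e.2 j)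
          = (k + 1) ^ ((N - (e.1.1 0).length) + (N - (e.1.1 1).length) - 1) := by
        intro j
        fin_cases i
        · simp [w, spl]; congr 1; simp at hlt; omega
        · simp [w, spl]; congr 1; simp at hlt; omega
      have h2 : w e
          = (k + 1) ^ ((N - (e.1.1 0).length) + (N - (e.1.1 1).length) - 1) * (k + 1) := by
        rw [← pow_succ]
        simp only [w]
        congr 1
        fin_cases i <;> simp at hlt <;> omega
      rw [NV.pairSplits, List.map_map, List.map_congr_left (f := w ∘ _) fun j _ => h1 j, h2]
      simp only [List.map_const', List.sum_replicate, List.length_finRange, smul_eq_mul]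
      nlinarith
    obtain ⟨K, hK, hPhi, hgr⟩ := ih ((NV.pairSplits i e ++ L.erase e).map w).sum (by
      rw [← hs, (hp.map w).sum_eq]
      simpa using hw) (hLe.pairSplits i) (by
      intro e' he' i'
      rcases List.mem_append.1 he' with h | h
      · obtain ⟨j, -, rfl⟩ := List.mem_map.1 h
        by_cases h : i' = i
        · subst h; simpa [spl] using hlt
        · simpa [spl, h] using hN e he i'
      · exact hN e' (List.mem_of_mem_erase h) i') rfl
    refine ⟨K, hK, ?_, hgr⟩
    rw [hPhi, Phi_pairSplits hk i (hLe.pairDis (by omega)),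
      Phi_perm (by omega) hp (hL.pairDis (by omega))]

lemma exists_length_le (L : List (Box k r × Box k r)) :
    ∃ N, ∀ e ∈ L, ∀ i, (e.1.1 i).length ≤ N := by
  induction L with
  | nil => simp
  | cons e L ih =>
    obtain ⟨N, hN⟩ := ih
    refine ⟨N + (e.1.1 0).length + (e.1.1 1).length, ?_⟩
    intro e' he' i
    rcases List.mem_cons.1 he' with rfl | h
    · fin_cases i <;> simp only [Fin.zero_eta, Fin.mk_one] <;> omega
    · have := hN e' h i; omega

lemma box_eq_of_not_dis {N : ℕ} {B B' : Box k r} (hB : ∀ i, (B.1 i).length = N)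
    (hB' : ∀ i, (B'.1 i).length = N) (h : ¬ Dis B B') : B = B' := by
  simp only [Dis, not_or, not_not, not_exists] at h
  exact Prod.ext (funext fun i => eq_of_not_inc ((hB i).trans (hB' i).symm) (h.2 i)) h.1

lemma IsTable.mem_of_domGrid (hk : 0 < k) {N : ℕ} (hL : IsTable γ L) (hN : DomGrid N L)
    {B : Box k r} (hB : ∀ i, (B.1 i).length = N) : ∃ e ∈ L, e.1 = B := by
  obtain ⟨e, he, hy⟩ := hL.cover (pt B fun _ _ => ⟨0, hk⟩)
  exact ⟨e, he, box_eq_of_not_dis (hN e he) hB (not_dis_of_mem hy (pt_mem _ _))⟩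

lemma box_eq_of_pt_eq (hk : 2 ≤ k) {B B' : Box k r} (h : ∀ x, pt B x = pt B' x) : B = B' := by
  refine Prod.ext (funext fun i => word_eq_of_concat_eq hk fun x => ?_) ?_
  · exact congrFun (Prod.ext_iff.1 (h fun _ => x)).1 i
  · exact (Prod.ext_iff.1 (h fun _ _ => ⟨0, by omega⟩)).2

lemma IsTable.nodup (hL : IsTable γ L) : L.Nodup := by
  refine hL.dis.imp fun {e e'} h he => ?_
  subst he
  exact not_dis_self _ h

lemma IsTable.subset_of_domGrid (hk : 2 ≤ k) {N : ℕ} (hL : IsTable γ L) (hK : IsTable γ K)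
    (hLN : DomGrid N L) (hKN : DomGrid N K) : L ⊆ K := by
  intro e he
  obtain ⟨e', he', h⟩ := hK.mem_of_domGrid (by omega) hKN (hLN e he)
  have : e'.2 = e.2 := box_eq_of_pt_eq hk fun x => by
    rw [← hK.valid e' he', h, hL.valid e he]
  rwa [← Prod.ext h this]

lemma IsTable.perm_of_domGrid (hk : 2 ≤ k) {N : ℕ} (hL : IsTable γ L) (hK : IsTable γ K)
    (hLN : DomGrid N L) (hKN : DomGrid N K) : L.Perm K :=
  (List.perm_ext_iff_of_nodup hL.nodup hK.nodup).2 fun _ =>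
    ⟨fun h => hL.subset_of_domGrid hk hK hLN hKN h, fun h => hK.subset_of_domGrid hk hL hKN hLN h⟩

/-- The number `Phi` does not depend on the table of a homeomorphism. -/
lemma IsTable.Phi_eq (hk : k % 4 = 3) (hL : IsTable γ L) (hK : IsTable γ K) : Phi L = Phi K := by
  obtain ⟨N, hN⟩ := exists_length_le L
  obtain ⟨M, hM⟩ := exists_length_le K
  obtain ⟨L', hL', h1, hLN⟩ :=
    exists_domGrid hk hL (N := N + M) fun e he i => (hN e he i).trans (by omega)
  obtain ⟨K', hK', h2, hKN⟩ :=
    exists_domGrid hk hK (N := N + M) fun e he i => (hM e he i).trans (by omega)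
  rw [← h1, ← h2]
  exact Phi_perm (by omega) (hL'.perm_of_domGrid (by omega) hK' hLN hKN) (hL'.pairDis (by omega))

/-- The number `Phi` is additive under composition. -/
lemma IsTable.Phi_mul (hk : k % 4 = 3) (hL : IsTable δ L) (hK : IsTable γ K) :
    ∃ M, IsTable (γ * δ) M ∧ Phi M = Phi K + Phi L := by
  have h0 : 0 < k := by omega
  obtain ⟨N₁, hN₁⟩ := exists_length_le (L.map Prod.swap)
  obtain ⟨N₂, hN₂⟩ := exists_length_le K
  obtain ⟨L', hL', h1, hLN⟩ :=
    exists_domGrid hk (hL.inv h0) (N := N₁ + N₂) fun e he i => (hN₁ e he i).trans (by omega)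
  obtain ⟨K', hK', h2, hKN⟩ :=
    exists_domGrid hk hK (N := N₁ + N₂) fun e he i => (hN₂ e he i).trans (by omega)
  have hL'' := hL'.inv h0
  rw [inv_inv] at hL''
  have hex : ∀ B : Box k r, ∃ V : Box k r, (∀ i, (B.1 i).length = N₁ + N₂) → (B, V) ∈ K' := by
    intro B
    by_cases hB : ∀ i, (B.1 i).length = N₁ + N₂
    · obtain ⟨e, he, rfl⟩ := hK'.mem_of_domGrid h0 hKN hB
      exact ⟨e.2, fun _ => he⟩
    · exact ⟨B, fun h => (hB h).elim⟩
  choose φ hφ using hex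
  have hKφ : IsTable γ (L'.map fun e => (e.1, φ e.1)) :=
    { valid := by
        intro e he
        obtain ⟨e', he', rfl⟩ := List.mem_map.1 he
        exact hK'.valid _ (hφ _ (hLN e' he'))
      cover := by
        intro y
        obtain ⟨e, he, hy⟩ := hL'.cover y
        exact ⟨_, List.mem_map_of_mem he, hy⟩
      dis := by
        rw [List.pairwise_map]
        exact hL'.dis }
  refine ⟨L'.map fun e => (e.2, φ e.1), ⟨?_, ?_, ?_⟩, ?_⟩
  · intro e he x
    obtain ⟨e', he', rfl⟩ := List.mem_map.1 he
    have h := hL''.valid e'.swap (List.mem_map_of_mem he') x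
    change δ (pt e'.2 x) = pt e'.1 x at h
    rw [Equiv.Perm.mul_apply, h]
    exact hK'.valid _ (hφ _ (hLN e' he')) x
  · intro y
    obtain ⟨e, he, hy⟩ := hL''.cover y
    obtain ⟨e', he', rfl⟩ := List.mem_map.1 he
    exact ⟨_, List.mem_map_of_mem he', hy⟩
  · rw [List.pairwise_map]
    exact (hL'.pairDis h0).imp fun h => h.2
  · have h3 := hK.Phi_eq hk hKφ
    rw [Phi_swap] at h1
    simp only [Phi, List.map_map] at h1 h3 ⊢
    change ori (L'.map fun e => φ e.1) - ori (L'.map Prod.snd) = _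
    change _ = ori (L'.map fun e => φ e.1) - ori (L'.map Prod.fst) at h3
    linear_combination -h1 - h3

lemma IsTable.isElement (hL : IsTable γ L) : IsElement γ := by
  have huniq : ∀ {γ : Equiv.Perm (Y 2 k r)} {L : List (Box k r × Box k r)}, IsTable γ L →
      ∀ y : Y 2 k r, ∃! t : Fin L.length, y ∈ box (L.get t).1.1 (L.get t).1.2 := by
    intro γ L hL y
    obtain ⟨e, he, hy⟩ := hL.cover y
    obtain ⟨t, rfl⟩ := List.get_of_mem he
    refine ⟨t, hy, fun t' ht' => ?_⟩
    by_contra hne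
    rcases lt_or_gt_of_ne hne with h | h
    · exact not_dis_of_mem ht' hy (List.pairwise_iff_get.1 hL.dis t' t h)
    · exact not_dis_of_mem hy ht' (List.pairwise_iff_get.1 hL.dis t t' h)
  refine ⟨L.length, fun t => (L.get t).1.1, fun t => (L.get t).2.1, fun t => (L.get t).1.2,
    fun t => (L.get t).2.2, huniq hL, ?_, fun t x => hL.valid _ (List.get_mem L t) x⟩
  intro y
  obtain ⟨t, ⟨x, hx⟩, hu⟩ := huniq hL (γ⁻¹ y)
  have key : ∀ t, y ∈ box (L.get t).2.1 (L.get t).2.2 ↔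
      γ⁻¹ y ∈ box (L.get t).1.1 (L.get t).1.2 := by
    intro t
    refine exists_congr fun x => ?_
    rw [Equiv.Perm.inv_eq_iff_eq]
    exact Eq.congr_right (hL.valid _ (List.get_mem L t) x).symm
  exact ⟨t, (key t).2 ⟨x, hx⟩, fun t' ht' => hu t' ((key t').1 ht')⟩

lemma exists_isTable (hk : 0 < k) (h : IsElement γ) : ∃ L, IsTable γ L := by
  obtain ⟨m, u, v, a, b, hu, -, hγ⟩ := h
  refine ⟨(List.finRange m).map fun t => ((u t, a t), (v t, b t)), ?_, ?_, ?_⟩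
  · intro e he x
    obtain ⟨t, -, rfl⟩ := List.mem_map.1 he
    exact hγ t x
  · intro y
    obtain ⟨t, ht, -⟩ := hu y
    exact ⟨_, List.mem_map_of_mem (List.mem_finRange t), ht⟩
  · rw [List.pairwise_map]
    refine (List.nodup_finRange m).imp fun {t t'} h => ?_
    by_contra hn
    obtain ⟨y, hy, hy'⟩ := exists_mem_of_not_dis hk hn
    exact h ((hu y).unique hy hy')

/-- The homeomorphism that moves the first letter of the first coordinate to the second coordinate
on the component `a`. -/
def baker (k : ℕ) (a : Fin r) : Equiv.Perm (Y 2 k r) where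
  toFun y := if y.2 = a then (![fun n => y.1 0 (n + 1), scons (y.1 0 0) (y.1 1)], y.2) else y
  invFun y := if y.2 = a then (![scons (y.1 1 0) (y.1 0), fun n => y.1 1 (n + 1)], y.2) else y
  left_inv y := by
    by_cases h : y.2 = a
    · simp only [h, if_true]
      refine Prod.ext (funext fun i => ?_) h.symm
      fin_cases i
      · exact scons_head_tail (y.1 0)
      · rfl
    · simp [h]
  right_inv y := by
    by_cases h : y.2 = a
    · simp only [h, if_true]
      refine Prod.ext (funext fun i => ?_) h.symm
      fin_cases i
      · rfl
      · exact scons_head_tail (y.1 1)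
    · simp [h]

lemma exists_isTable_baker (hk : k % 4 = 3) (a : Fin r) :
    ∃ L, IsTable (baker k a) L ∧ Phi L = -(k : ZMod (2 * k - 2)) := by
  let B : Fin r → Box k r := fun b => (fun _ => [], b)
  let R : List (Box k r) := ((List.finRange r).erase a).map B
  have hB : ∀ y : Y 2 k r, y ∈ box (B y.2).1 (B y.2).2 := fun y =>
    ⟨y.1, by simp [B, concat_nil]⟩
  have hne : ∀ b ∈ (List.finRange r).erase a, a ≠ b := fun b hb h =>
    (List.nodup_finRange r).not_mem_erase (h ▸ hb)
  have hR : ∀ B' ∈ R, Dis (B a) B' := by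
    intro B' hB'
    obtain ⟨b, hb, rfl⟩ := List.mem_map.1 hB'
    exact Or.inl (hne b hb)
  refine ⟨(List.finRange k).map (fun j => (spl 0 (B a) j, spl 1 (B a) j)) ++
    R.map fun B => (B, B), ⟨?_, ?_, ?_⟩, ?_⟩
  · intro e he x
    rcases List.mem_append.1 he with h | h
    · obtain ⟨j, -, rfl⟩ := List.mem_map.1 h
      refine (if_pos rfl).trans (Prod.ext (funext fun i => ?_) rfl)
      fin_cases i
      · simp [pt, spl, B, concat_cons, concat_nil, scons]
      · simp [pt, spl, B, concat_cons, concat_nil, scons]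
    · obtain ⟨_, h', rfl⟩ := List.mem_map.1 h
      obtain ⟨b, hb, rfl⟩ := List.mem_map.1 h'
      exact if_neg (hne b hb).symm
  · intro y
    by_cases h : y.2 = a
    · obtain ⟨j, hj⟩ := exists_mem_spl 0 (hB y)
      rw [h] at hj
      exact ⟨_, List.mem_append_left _ (List.mem_map_of_mem (List.mem_finRange j)), hj⟩
    · refine ⟨(B y.2, B y.2), List.mem_append_right _ (List.mem_map_of_mem
        (List.mem_map_of_mem ?_)), hB y⟩
      exact (List.mem_erase_of_ne h).2 (List.mem_finRange _)
  · refine List.pairwise_append.2 ⟨?_, ?_, ?_⟩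
    · rw [List.pairwise_map]
      exact (List.nodup_finRange k).imp fun h => dis_spl_spl 0 (B a) h
    · rw [List.pairwise_map, List.pairwise_map]
      exact ((List.nodup_finRange r).erase a).imp fun h => Or.inl h
    · intro e he e' he'
      obtain ⟨j, -, rfl⟩ := List.mem_map.1 he
      obtain ⟨B', h', rfl⟩ := List.mem_map.1 he'
      exact (hR B' h').spl_left 0 j
  · have h0 := ori_splits_append hk 0 hR
    have h1 := ori_splits_append hk 1 hR
    simp only [if_true, one_ne_zero, if_false] at h0 h1
    simp only [Phi, List.map_append, List.map_map]
    change ori (splits 1 (B a) ++ R.map id) - ori (splits 0 (B a) ++ R.map id) = _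
    rw [List.map_id]
    linear_combination h1 - h0

end Tables

end NV

theorem statement12 (k r : ℕ) (hk : 3 ≤ k) (hk4 : k % 4 = 3) (hr : 1 ≤ r)
    (G : Subgroup (Equiv.Perm (NV.Y 2 k r)))
    (hG : (G : Set (Equiv.Perm (NV.Y 2 k r))) = NV.thompsonSet 2 k r) :
    ∃ f : ↥G →* Multiplicative (ZMod (2 * k - 2)), Function.Surjective f := by
  have h0 : 0 < k := by omega
  have hG' : ∀ γ, γ ∈ G ↔ NV.IsElement γ := fun γ => by
    rw [← SetLike.mem_coe, hG]
    rfl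
  choose T hT using fun γ : G => NV.exists_isTable h0 ((hG' γ).1 γ.2)
  let f : G →* Multiplicative (ZMod (2 * k - 2)) :=
    MonoidHom.mk' (fun γ => Multiplicative.ofAdd (NV.Phi (T γ))) fun γ δ => by
      obtain ⟨M, hM, hPhi⟩ := (hT δ).Phi_mul hk4 (hT γ)
      rw [← ofAdd_add, ← hPhi]
      exact congrArg _ ((hT (γ * δ)).Phi_eq hk4 hM)
  obtain ⟨L, hL, hPhi⟩ := NV.exists_isTable_baker hk4 (⟨0, hr⟩ : Fin r)
  let g : G := ⟨NV.baker k ⟨0, hr⟩, (hG' _).2 hL.isElement⟩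
  have hfg : f g = Multiplicative.ofAdd (-(k : ZMod (2 * k - 2))) := by
    rw [← hPhi]
    exact congrArg Multiplicative.ofAdd ((hT g).Phi_eq hk4 hL)
  refine ⟨f, fun z => ?_⟩
  have : NeZero (2 * k - 2) := ⟨by omega⟩
  refine ⟨g ^ (-(k * Multiplicative.toAdd z) : ZMod (2 * k - 2)).val, ?_⟩
  rw [map_pow, hfg, ← ofAdd_nsmul, nsmul_eq_mul, ZMod.natCast_zmod_val]
  apply Multiplicative.toAdd.injective
  rw [toAdd_ofAdd]
  linear_combination Multiplicative.toAdd z * NV.cast_mul_self hk4
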